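/- arXiv:2004.06807 — 2 statements merged into one kernel-verified Lean document; each statement's English description precedes it below -/
import Mathlib

section
/- (Finite time breakdown along characteristics) Let k < 0, ν ≥ 0 and c₂ > 0, and let c : [0, ∞) → ℝ be continuous with c(t) ≤ c₂ for all t. Set λ₂ = (ν + √(ν² - 4kc₂))/2. Suppose ρ₀ ≥ 0 and d₀ < (λ₂/c₂)(ρ₀ - c₂). Then there do not exist differentiable functions ρ, d : [0, ∞) → ℝ with ρ(0) = ρ₀, d(0) = d₀ satisfying ρ'(t) = -ρ(t) d(t) and d'(t) = -d(t)² - ν d(t) + k(ρ(t) - c(t)) for all t ≥ 0; that is, the solution blows up (ρ → +∞ and d → -∞) in finite time. -/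
/-- A function with nonpositive derivative on `[0, ∞)` is bounded above by its initial value. -/
theorem le_initial_of_hasDerivWithinAt_nonpos {f f' : ℝ → ℝ}
    (hf : ∀ t : ℝ, 0 ≤ t → HasDerivWithinAt f (f' t) (Set.Ici 0) t)
    (hf' : ∀ t : ℝ, 0 ≤ t → f' t ≤ 0) {t : ℝ} (ht : 0 ≤ t) : f t ≤ f 0 := by
  have hanti : AntitoneOn f (Set.Ici 0) :=
    antitoneOn_of_hasDerivWithinAt_nonpos (convex_Ici 0)
      (fun x hx => (hf x hx).continuousWithinAt)
      (fun x hx => (hf x (interior_subset hx)).mono interior_subset)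
      (fun x hx => hf' x (interior_subset hx))
  exact hanti (Set.mem_Ici.2 le_rfl) ht ht

/-- A function continuous on `[0, ∞)` is the logarithmic derivative there of a positive function
with initial value `1`. -/
theorem exists_pos_hasDerivWithinAt_mul {d : ℝ → ℝ} (hd : ContinuousOn d (Set.Ici 0)) :
    ∃ q : ℝ → ℝ, q 0 = 1 ∧ (∀ t, 0 < q t) ∧
      ∀ t : ℝ, 0 ≤ t → HasDerivWithinAt q (q t * d t) (Set.Ici 0) t := by
  have hD : Continuous fun t : ℝ => d (max t 0) :=
    hd.comp_continuous (by fun_prop) fun t => le_max_right t 0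
  refine ⟨fun t => Real.exp (∫ x in (0 : ℝ)..t, d (max x 0)), by simp,
    fun t => Real.exp_pos _, fun t ht => ?_⟩
  have h := (hD.integral_hasStrictDerivAt 0 t).hasDerivAt.exp.hasDerivWithinAt (s := Set.Ici 0)
  rwa [max_eq_left ht] at h

/-- The function `1 + A t + w t + w μ t² / 2` takes a nonpositive value at some `t ≥ 0` when
`w < 0 < μ`. -/
theorem exists_quadratic_nonpos {A w μ : ℝ} (hA : 0 ≤ A) (hw : w < 0) (hμ : 0 < μ) :
    ∃ t : ℝ, 0 ≤ t ∧ 1 + A * t + w * t + w * μ * t ^ 2 / 2 ≤ 0 := by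
  have hN : 0 < -(w * μ) / 2 := by nlinarith
  obtain ⟨N, hNdef⟩ : ∃ N, N = -(w * μ) / 2 := ⟨_, rfl⟩
  rw [← hNdef] at hN
  have h1 : 1 ≤ (A + 1 + N) / N := by rw [le_div_iff₀ hN]; linarith
  obtain ⟨t, htdef⟩ : ∃ t, t = (A + 1 + N) / N := ⟨_, rfl⟩
  rw [← htdef] at h1
  have h2 : N * t = A + 1 + N := by rw [htdef]; field_simp
  have h3 : w * μ * t ^ 2 / 2 = -(t * (A + 1 + N)) := by
    rw [← h2, hNdef]; ring
  refine ⟨t, by linarith, ?_⟩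
  rw [h3]
  nlinarith [mul_pos hN (by linarith : 0 < t), mul_neg_of_neg_of_pos hw (by linarith : 0 < t)]


/-- Finite time breakdown along characteristics:
for the characteristic system `ρ' = -ρd`, `d' = -d² - νd + k(ρ - c(t))` with
`c(t) ≤ c₂`, supercritical data `ρ₀ ≥ 0`, `d₀ < (λ₂/c₂)(ρ₀ - c₂)` admit no
global differentiable solution on `[0, ∞)` (the solution blows up in finite time). -/
theorem finite_time_breakdown
    (k ν c₂ : ℝ) (hk : k < 0) (hν : 0 ≤ ν) (hc₂ : 0 < c₂)
    (c : ℝ → ℝ) (hc_cont : Continuous c) (hc : ∀ t : ℝ, 0 ≤ t → c t ≤ c₂)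
    (lam₂ : ℝ)
    (hlam₂ : lam₂ = (ν + Real.sqrt (ν ^ 2 - 4 * k * c₂)) / 2)
    (ρ₀ d₀ : ℝ) (hρ0 : 0 ≤ ρ₀) (hd0 : d₀ < (lam₂ / c₂) * (ρ₀ - c₂)) :
    ¬ ∃ ρ d : ℝ → ℝ, ρ 0 = ρ₀ ∧ d 0 = d₀ ∧
      (∀ t : ℝ, 0 ≤ t →
        HasDerivWithinAt ρ (-(ρ t) * d t) (Set.Ici (0 : ℝ)) t) ∧
      (∀ t : ℝ, 0 ≤ t →
        HasDerivWithinAt d (-(d t) ^ 2 - ν * d t + k * (ρ t - c t))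
          (Set.Ici (0 : ℝ)) t) := by
  rintro ⟨ρ, d, hρi, hdi, hρ, hd⟩
  have hkc : k * c₂ < 0 := mul_neg_of_neg_of_pos hk hc₂
  have hdisc : 0 ≤ ν ^ 2 - 4 * k * c₂ := by nlinarith [sq_nonneg ν]
  have hroot : lam₂ ^ 2 - ν * lam₂ + k * c₂ = 0 := by
    rw [hlam₂]; nlinarith [Real.sq_sqrt hdisc]
  have hμ : 0 < lam₂ - ν := by
    have : ν < Real.sqrt (ν ^ 2 - 4 * k * c₂) := Real.lt_sqrt_of_sq_lt (by linarith)
    rw [hlam₂]; linarith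
  have hlam : 0 < lam₂ := by linarith
  obtain ⟨a, ha⟩ : ∃ a, a = lam₂ / c₂ := ⟨_, rfl⟩
  have hapos : 0 < a := ha ▸ div_pos hlam hc₂
  have hac : a * c₂ = lam₂ := by rw [ha]; field_simp
  have hak : (lam₂ - ν) * a + k = 0 := by
    apply mul_right_cancel₀ hc₂.ne'
    linear_combination (lam₂ - ν) * hac + hroot
  obtain ⟨w, hw⟩ : ∃ w, w = d₀ + lam₂ - a * ρ₀ := ⟨_, rfl⟩
  have hwneg : w < 0 := by
    rw [← ha] at hd0
    rw [hw]; linarith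
  obtain ⟨μ, hμdef⟩ : ∃ μ, μ = lam₂ - ν := ⟨_, rfl⟩
  rw [← hμdef] at hμ hak
  obtain ⟨q, hq0, hqpos, hq⟩ :=
    exists_pos_hasDerivWithinAt_mul fun t ht => (hd t ht).continuousWithinAt
  have hmass : ∀ t : ℝ, 0 ≤ t → ρ t * q t = ρ₀ := by
    intro t ht
    have hup := le_initial_of_hasDerivWithinAt_nonpos (fun s hs => (hρ s hs).mul (hq s hs))
      (fun s _ => le_of_eq (by ring)) ht
    have hlow := le_initial_of_hasDerivWithinAt_nonpos
      (fun s hs => ((hρ s hs).mul (hq s hs)).neg) (fun s _ => le_of_eq (by ring)) ht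
    simp only [Pi.mul_apply, Pi.neg_apply, hρi, hq0] at hup hlow
    linarith
  have hexp : ∀ r t : ℝ, HasDerivWithinAt (fun s => Real.exp (r * s)) (Real.exp (r * t) * r)
      (Set.Ici 0) t := fun r t => by
    simpa using ((hasDerivAt_id t).const_mul r).exp.hasDerivWithinAt
  have hdecay : ∀ t : ℝ, 0 ≤ t →
      Real.exp (-μ * t) * ((d t + lam₂ - a * ρ t) * q t) ≤ w := by
    intro t ht
    have h := le_initial_of_hasDerivWithinAt_nonpos
      (fun s hs => (hexp (-μ) s).mul
        ((((hd s hs).add_const lam₂).sub ((hρ s hs).const_mul a)).mul (hq s hs)))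
      (fun s hs => ?_) ht
    · simpa [hρi, hdi, hq0, ← hw] using h
    · have hforce : k * (c₂ - c s) ≤ 0 :=
        mul_nonpos_of_nonpos_of_nonneg hk.le (by linarith [hc s hs])
      have hE : 0 < Real.exp (-μ * s) * q s := mul_pos (Real.exp_pos _) (hqpos s)
      refine le_of_eq_of_le ?_ (mul_nonpos_of_nonneg_of_nonpos hE.le hforce)
      simp only [Pi.sub_apply, Pi.mul_apply]
      linear_combination (Real.exp (-μ * s) * q s) * (ρ s * hak - hroot
        - (d s + lam₂) * hμdef)
  have hslope : ∀ t : ℝ, 0 ≤ t → q t * d t - a * ρ₀ - w * Real.exp (μ * t) ≤ 0 := by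
    intro t ht
    have h := mul_le_mul_of_nonneg_left (hdecay t ht) (Real.exp_pos (μ * t)).le
    rw [← mul_assoc, ← Real.exp_add, show μ * t + -μ * t = 0 by ring, Real.exp_zero, one_mul] at h
    have := mul_pos hlam (hqpos t)
    have := hmass t ht
    nlinarith
  obtain ⟨t, ht, hneg⟩ := exists_quadratic_nonpos (mul_nonneg hapos.le hρ0) hwneg hμ
  have hbound := le_initial_of_hasDerivWithinAt_nonpos
    (fun s hs => ((hq s hs).sub ((hasDerivWithinAt_id s _).const_mul (a * ρ₀))).sub
      ((hexp μ s).const_mul (w / μ)))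
    (fun s hs => le_of_eq_of_le (by field_simp) (hslope s hs)) ht
  simp only [Pi.sub_apply, id, hq0, mul_zero, Real.exp_zero] at hbound
  have hquad := mul_le_mul_of_nonpos_left
    (Real.quadratic_le_exp_of_nonneg (mul_nonneg hμ.le ht)) (div_neg_of_neg_of_pos hwneg hμ).le
  have hexpand : w / μ * (1 + μ * t + (μ * t) ^ 2 / 2) = w / μ + w * t + w * μ * t ^ 2 / 2 := by
    field_simp
  linarith [hqpos t]
end

section
/- (Sharp critical threshold for constant background) Let k < 0, ν ≥ 0, c > 0, and set λ = (ν + √(ν² - 4kc))/2. Given ρ₀ ≥ 0 and d₀ ∈ ℝ, there exist differentiable functions ρ, d : [0, ∞) → ℝ with ρ(0) = ρ₀, d(0) = d₀ satisfying ρ'(t) = -ρ(t) d(t) and d'(t) = -d(t)² - ν d(t) + k(ρ(t) - c) for all t ≥ 0 if and only if d₀ ≥ (λ/c)(ρ₀ - c). -/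
/-- A function with `f' = a f` on `[0, ∞)` is an exponential there. -/
theorem eq_mul_exp_of_hasDerivWithinAt_Ici {f : ℝ → ℝ} {a : ℝ}
    (hf : ∀ t : ℝ, 0 ≤ t → HasDerivWithinAt f (a * f t) (Set.Ici (0 : ℝ)) t)
    {t : ℝ} (ht : 0 ≤ t) : f t = f 0 * Real.exp (a * t) := by
  have hderiv : ∀ s : ℝ, 0 ≤ s →
      HasDerivWithinAt (fun x => f x * Real.exp (-(a * x))) 0 (Set.Ici (0 : ℝ)) s := by
    intro s hs
    have hexp : HasDerivAt (fun x : ℝ => Real.exp (-(a * x)))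
        (Real.exp (-(a * s)) * (-(a * 1))) s :=
      ((hasDerivAt_id s).const_mul a).neg.exp
    exact ((hf s hs).mul hexp.hasDerivWithinAt).congr_deriv (by ring)
  have hconst := constant_of_has_deriv_right_zero (a := 0) (b := t)
    (fun s hs => (hderiv s hs.1).continuousWithinAt.mono Set.Icc_subset_Ici_self)
    (fun s hs => (hderiv s hs.1).mono (Set.Ici_subset_Ici.2 hs.1)) t ⟨ht, le_rfl⟩
  simp only [mul_zero, neg_zero, Real.exp_zero, mul_one] at hconst
  rw [← hconst, mul_assoc, ← Real.exp_add]
  simp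

/-- A function continuous on `[0, ∞)` is the logarithmic derivative of a positive function there,
normalized at `0`. -/
theorem exists_pos_hasDerivWithinAt_mul_self {d : ℝ → ℝ} (hd : ContinuousOn d (Set.Ici 0)) :
    ∃ G : ℝ → ℝ, G 0 = 1 ∧ (∀ t, 0 < G t) ∧
      ∀ t : ℝ, 0 ≤ t → HasDerivWithinAt G (d t * G t) (Set.Ici (0 : ℝ)) t := by
  have hcont : Continuous fun s : ℝ => d (max s 0) :=
    hd.comp_continuous (by fun_prop) fun s => le_max_right s 0
  refine ⟨fun t => Real.exp (∫ s in (0 : ℝ)..t, d (max s 0)), by simp,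
    fun t => Real.exp_pos _, fun t ht => ?_⟩
  have h := (hcont.integral_hasStrictDerivAt 0 t).hasDerivAt.exp.hasDerivWithinAt (s := Set.Ici 0)
  exact h.congr_deriv (by rw [max_eq_left ht, mul_comm])

/-- Necessity of the threshold, in terms of the roots `l`, `-m`
of the characteristic polynomial `r ^ 2 - (l - m) r - l m`. -/
theorem threshold_le_of_global_solution {l m c : ℝ} (hl : 0 < l) (hm : 0 < m) (hc : 0 < c)
    {ρ d : ℝ → ℝ}
    (hρ : ∀ t : ℝ, 0 ≤ t → HasDerivWithinAt ρ (-(ρ t) * d t) (Set.Ici (0 : ℝ)) t)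
    (hd : ∀ t : ℝ, 0 ≤ t → HasDerivWithinAt d
      (-(d t) ^ 2 - (l - m) * d t + -(l * m / c) * (ρ t - c)) (Set.Ici (0 : ℝ)) t) :
    (l / c) * (ρ 0 - c) ≤ d 0 := by
  obtain ⟨G, hG0, hGpos, hG⟩ :=
    exists_pos_hasDerivWithinAt_mul_self fun t ht => (hd t ht).continuousWithinAt
  have hρG : ∀ t : ℝ, 0 ≤ t → ρ t * G t = ρ 0 := by
    intro t ht
    have h := eq_mul_exp_of_hasDerivWithinAt_Ici (f := fun t => ρ t * G t) (a := 0)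
      (fun s hs => ((hρ s hs).mul (hG s hs)).congr_deriv (by ring)) ht
    simpa [hG0] using h
  have hQ : ∀ t : ℝ, 0 ≤ t → (d t + l) * G t - l * ρ 0 / c =
      ((d 0 + l) * G 0 - l * ρ 0 / c) * Real.exp (m * t) := by
    intro t ht
    refine eq_mul_exp_of_hasDerivWithinAt_Ici (f := fun t => (d t + l) * G t - l * ρ 0 / c)
      (fun s hs => ((((hd s hs).add_const l).mul (hG s hs)).sub_const _).congr_deriv ?_) ht
    rw [← hρG s hs]
    field_simp
    ring
  have hR : ∀ t : ℝ, 0 ≤ t → (d t - m) * G t + m * ρ 0 / c =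
      ((d 0 - m) * G 0 + m * ρ 0 / c) * Real.exp (-l * t) := by
    intro t ht
    refine eq_mul_exp_of_hasDerivWithinAt_Ici (f := fun t => (d t - m) * G t + m * ρ 0 / c)
      (fun s hs => ((((hd s hs).sub_const m).mul (hG s hs)).add_const _).congr_deriv ?_) ht
    rw [← hρG s hs]
    field_simp
    ring
  by_contra! hlt
  rw [hG0] at hQ hR
  set q := (d 0 + l) * 1 - l * ρ 0 / c with hq
  set r := (d 0 - m) * 1 + m * ρ 0 / c with hr
  have hqneg : q < 0 := by
    have : (l / c) * (ρ 0 - c) = l * ρ 0 / c - l := by field_simp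
    linarith
  set M := |l * ρ 0 / c + m * ρ 0 / c| + |r| with hM
  have hMnonneg : 0 ≤ M := by positivity
  set t := M / (m * -q) with ht_def
  have hmq : 0 < m * -q := mul_pos hm (neg_pos.2 hqneg)
  have ht : 0 ≤ t := div_nonneg hMnonneg hmq.le
  have htM : t * (m * -q) = M := div_mul_cancel₀ _ hmq.ne'
  have hexp : m * t + 1 ≤ Real.exp (m * t) := Real.add_one_le_exp _
  have hdecay : Real.exp (-l * t) ≤ 1 :=
    Real.exp_le_one_iff.2 (by nlinarith [mul_nonneg hl.le ht])
  have hrt : -(r * Real.exp (-l * t)) ≤ |r| := by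
    refine (neg_le_abs _).trans ?_
    rw [abs_mul, abs_of_pos (Real.exp_pos _)]
    exact mul_le_of_le_one_right (abs_nonneg r) hdecay
  have hGt : 0 < (l + m) * G t := mul_pos (add_pos hl hm) (hGpos t)
  have hdiff := hQ t ht
  have hdiff' := hR t ht
  have hle := le_abs_self (l * ρ 0 / c + m * ρ 0 / c)
  have hgrow := mul_le_mul_of_nonneg_left hexp (neg_pos.2 hqneg).le
  nlinarith

/-- Sufficiency of the threshold, in terms of the roots `l`, `-m`
of the characteristic polynomial `r ^ 2 - (l - m) r - l m`. -/
theorem exists_global_solution_of_threshold_le {l m c ρ₀ d₀ : ℝ} (hl : 0 < l) (hm : 0 < m)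
    (hc : 0 < c) (hρ₀ : 0 ≤ ρ₀) (h : (l / c) * (ρ₀ - c) ≤ d₀) :
    ∃ ρ d : ℝ → ℝ, ρ 0 = ρ₀ ∧ d 0 = d₀ ∧
      (∀ t : ℝ, 0 ≤ t → HasDerivAt ρ (-(ρ t) * d t) t) ∧
      (∀ t : ℝ, 0 ≤ t → HasDerivAt d
        (-(d t) ^ 2 - (l - m) * d t + -(l * m / c) * (ρ t - c)) t) := by
  have hlm : 0 < l + m := add_pos hl hm
  obtain ⟨A, hA⟩ : ∃ A, A = (d₀ - (l / c) * (ρ₀ - c)) / (l + m) := ⟨_, rfl⟩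
  obtain ⟨B, hB⟩ : ∃ B, B = 1 - ρ₀ / c - A := ⟨_, rfl⟩
  have hA0 : 0 ≤ A := hA ▸ div_nonneg (sub_nonneg.2 h) hlm.le
  have hinit : m * A - l * B = d₀ := by
    rw [hB, hA]
    field_simp
    ring
  have hexp : ∀ a t : ℝ, HasDerivAt (fun x : ℝ => Real.exp (a * x)) (a * Real.exp (a * t)) t :=
    fun a t => (((hasDerivAt_id t).const_mul a).exp).congr_deriv (by simp [mul_comm])
  let G : ℝ → ℝ := fun t => ρ₀ / c + A * Real.exp (m * t) + B * Real.exp (-l * t)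
  let H : ℝ → ℝ := fun t => A * (m * Real.exp (m * t)) + B * (-l * Real.exp (-l * t))
  have hG : ∀ t, HasDerivAt G (H t) t := fun t =>
    (((hexp m t).const_mul A).const_add (ρ₀ / c)).add ((hexp (-l) t).const_mul B)
  have hH : ∀ t, HasDerivAt H (-(l - m) * H t - l * m * (ρ₀ / c - G t)) t := fun t =>
    ((((hexp m t).const_mul m).const_mul A).add
      (((hexp (-l) t).const_mul (-l)).const_mul B)).congr_deriv (by simp only [G, H]; ring)
  have hG0 : G 0 = 1 := by simp [G, hB]
  have hH0 : H 0 = d₀ := by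
    rw [← hinit]
    simp only [H, mul_zero, Real.exp_zero]
    ring
  have hGpos : ∀ t : ℝ, 0 ≤ t → 0 < G t := by
    intro t ht
    have hdecay : Real.exp (-l * t) ≤ 1 :=
      Real.exp_le_one_iff.2 (by nlinarith [mul_nonneg hl.le ht])
    have hgrow : 1 ≤ Real.exp (m * t) := Real.one_le_exp (mul_nonneg hm.le ht)
    have hsum : G t = ρ₀ / c * (1 - Real.exp (-l * t)) +
        A * (Real.exp (m * t) - Real.exp (-l * t)) + Real.exp (-l * t) := by
      simp only [G, hB]
      ring
    rw [hsum]
    have h₁ := mul_nonneg (div_nonneg hρ₀ hc.le) (sub_nonneg.2 hdecay)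
    have h₂ := mul_nonneg hA0 (sub_nonneg.2 (hdecay.trans hgrow))
    linarith [Real.exp_pos (-l * t)]
  refine ⟨fun t => ρ₀ / G t, fun t => H t / G t, by simp [hG0], by simp [hG0, hH0],
    fun t ht => ?_, fun t ht => ?_⟩
  · have hne := (hGpos t ht).ne'
    refine ((hasDerivAt_const t ρ₀).div (hG t) hne).congr_deriv ?_
    field_simp
    ring
  · have hne := (hGpos t ht).ne'
    refine ((hH t).div (hG t) hne).congr_deriv ?_
    field_simp
    ring


/-- Sharp critical threshold for constant background:
the characteristic system `ρ' = -ρd`, `d' = -d² - νd + k(ρ - c)` with constant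
background `c > 0` admits a global differentiable solution on `[0, ∞)` with data
`(ρ₀, d₀)`, `ρ₀ ≥ 0`, if and only if `d₀ ≥ (λ/c)(ρ₀ - c)`. -/
theorem sharp_threshold_constant_background
    (k ν c : ℝ) (hk : k < 0) (hν : 0 ≤ ν) (hc : 0 < c)
    (lam : ℝ)
    (hlam : lam = (ν + Real.sqrt (ν ^ 2 - 4 * k * c)) / 2)
    (ρ₀ d₀ : ℝ) (hρ0 : 0 ≤ ρ₀) :
    (∃ ρ d : ℝ → ℝ, ρ 0 = ρ₀ ∧ d 0 = d₀ ∧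
      (∀ t : ℝ, 0 ≤ t →
        HasDerivWithinAt ρ (-(ρ t) * d t) (Set.Ici (0 : ℝ)) t) ∧
      (∀ t : ℝ, 0 ≤ t →
        HasDerivWithinAt d (-(d t) ^ 2 - ν * d t + k * (ρ t - c))
          (Set.Ici (0 : ℝ)) t)) ↔
    (lam / c) * (ρ₀ - c) ≤ d₀ := by
  have hkc : 0 < -(k * c) := by nlinarith [mul_pos (neg_pos.2 hk) hc]
  have hdisc : 0 ≤ ν ^ 2 - 4 * k * c := by nlinarith [sq_nonneg ν]
  have hsq := Real.sq_sqrt hdisc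
  have hlt : ν < Real.sqrt (ν ^ 2 - 4 * k * c) := Real.lt_sqrt_of_sq_lt (by nlinarith)
  obtain ⟨m, hm⟩ : ∃ m, m = lam - ν := ⟨_, rfl⟩
  have hl_pos : 0 < lam := by linarith
  have hm_pos : 0 < m := by linarith
  obtain rfl : ν = lam - m := by linarith
  have hprod : lam * m = -(k * c) := by
    have hs : Real.sqrt ((lam - m) ^ 2 - 4 * k * c) = lam + m := by linarith
    rw [hs] at hsq
    linarith
  obtain rfl : k = -(lam * m / c) := by
    field_simp
    linarith
  constructor
  · rintro ⟨ρ, d, rfl, rfl, hρ, hd⟩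
    exact threshold_le_of_global_solution hl_pos hm_pos hc hρ hd
  · intro h
    obtain ⟨ρ, d, h₁, h₂, hρ, hd⟩ :=
      exists_global_solution_of_threshold_le hl_pos hm_pos hc hρ0 h
    exact ⟨ρ, d, h₁, h₂, fun t ht => (hρ t ht).hasDerivWithinAt,
      fun t ht => (hd t ht).hasDerivWithinAt⟩
end
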